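/- arXiv:1212.0889 — 3 statements merged into one kernel-verified Lean document; each statement's English description precedes it below -/
import Mathlib

section
/- The twist maps F and G are measure-preserving bijections of the torus 𝕋 with respect to μ; consequently the linked-twist map H = G ∘ F is a measure-preserving bijection of (𝕋, μ), and moreover H maps the region R onto itself: H '' R = R. -/
open MeasureTheory
open scoped NNReal ENNReal

noncomputable section

instance : Fact ((0:ℝ) < 2) := ⟨by norm_num⟩

/-- The torus, as a product of two circles of circumference 2. -/
abbrev 𝕋 : Type := AddCircle (2:ℝ) × AddCircle (2:ℝ)

/-- The unique representative in `[0, 2)` of a point of the circle. -/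
def θ (x : AddCircle (2:ℝ)) : ℝ := ((AddCircle.equivIco 2 0) x : ℝ)

def P : Set 𝕋 := {z | θ z.2 ≤ 1}
def Q : Set 𝕋 := {z | θ z.1 ≤ 1}
def R : Set 𝕋 := P ∪ Q
def S : Set 𝕋 := P ∩ Q

/-- The horizontal twist map. -/
def F (z : 𝕋) : 𝕋 :=
  if θ z.2 ≤ 1 then (z.1 + (((2 * θ z.2 : ℝ) : AddCircle (2:ℝ))), z.2) else z

/-- The vertical twist map. -/
def G (z : 𝕋) : 𝕋 :=
  if θ z.1 ≤ 1 then (z.1, z.2 + (((2 * θ z.1 : ℝ) : AddCircle (2:ℝ)))) else z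

/-- The linked-twist map. -/
def H : 𝕋 → 𝕋 := G ∘ F

/-- The first-return time of `T` to `S`. -/
def rtn (T : 𝕋 → 𝕋) (z : 𝕋) : ℕ := sInf {n : ℕ | 1 ≤ n ∧ T^[n] z ∈ S}

/-- The first-return map of `T` to `S`. -/
def retMap (T : 𝕋 → 𝕋) (z : 𝕋) : 𝕋 := T^[rtn T z] z

/-- The set of points of `S` with return time exactly `n`. -/
def Sn (n : ℕ) : Set 𝕋 := {z | z ∈ S ∧ rtn H z = n}

/-- The amount by which each twist translates the fibre over a point of the circle. -/
def twistShift (x : AddCircle (2:ℝ)) : AddCircle (2:ℝ) :=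
  if θ x ≤ 1 then ((2 * θ x : ℝ) : AddCircle (2:ℝ)) else 0

lemma measurable_θ : Measurable θ :=
  measurable_subtype_coe.comp (AddCircle.measurableEquivIco 2 0).measurable

lemma measurable_twistShift : Measurable twistShift :=
  Measurable.ite (measurableSet_le measurable_θ measurable_const)
    (AddCircle.measurable_mk'.comp (measurable_θ.const_mul 2)) measurable_const

lemma G_eq_twistShift (z : 𝕋) : G z = (z.1, z.2 + twistShift z.1) := by
  unfold G twistShift
  split_ifs <;> simp

lemma F_eq_swap_comp_G_comp_swap : F = Prod.swap ∘ G ∘ Prod.swap := by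
  funext z
  simp only [F, G, Function.comp_apply, Prod.fst_swap, Prod.snd_swap]
  split_ifs <;> simp

lemma measurePreserving_G : MeasurePreserving G (volume : Measure 𝕋) volume := by
  have h : MeasurePreserving
      (fun z : 𝕋 => (id z.1, (fun x y => y + twistShift x) z.1 z.2))
      ((volume : Measure (AddCircle (2:ℝ))).prod volume)
      ((volume : Measure (AddCircle (2:ℝ))).prod volume) :=
    (MeasurePreserving.id volume).skew_product
      (measurable_snd.add (measurable_twistShift.comp measurable_fst))
      (Filter.Eventually.of_forall fun x =>
        (measurePreserving_add_right volume (twistShift x)).map_eq)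
  rw [show G = _ from funext G_eq_twistShift]
  exact h

lemma bijective_G : Function.Bijective G := by
  refine Function.bijective_iff_has_inverse.2 ⟨fun z => (z.1, z.2 - twistShift z.1), ?_, ?_⟩ <;>
    intro z <;> simp [G_eq_twistShift]

lemma measurePreserving_F : MeasurePreserving F (volume : Measure 𝕋) volume := by
  rw [F_eq_swap_comp_G_comp_swap]
  exact Measure.measurePreserving_swap.comp
    (measurePreserving_G.comp Measure.measurePreserving_swap)

lemma bijective_F : Function.Bijective F := by
  rw [F_eq_swap_comp_G_comp_swap]
  exact Prod.swap_bijective.comp (bijective_G.comp Prod.swap_bijective)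

lemma F_mem_R_iff (z : 𝕋) : F z ∈ R ↔ z ∈ R := by
  by_cases h : θ z.2 ≤ 1 <;> simp [F, R, P, h]

lemma G_mem_R_iff (z : 𝕋) : G z ∈ R ↔ z ∈ R := by
  by_cases h : θ z.1 ≤ 1 <;> simp [G, R, Q, h]

lemma H_preimage_R : H ⁻¹' R = R :=
  Set.ext fun z => (G_mem_R_iff (F z)).trans (F_mem_R_iff z)

/-- `F` and `G` are measure-preserving bijections of the torus; hence so is `H = G ∘ F`,
and `H` maps the region `R` onto itself. -/
theorem twists_measurePreserving_bijective :
    MeasurePreserving F (volume : Measure 𝕋) volume ∧ Function.Bijective F ∧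
    MeasurePreserving G (volume : Measure 𝕋) volume ∧ Function.Bijective G ∧
    MeasurePreserving H (volume : Measure 𝕋) volume ∧ Function.Bijective H ∧
    H '' R = R := by
  have hH : Function.Bijective H := bijective_G.comp bijective_F
  refine ⟨measurePreserving_F, bijective_F, measurePreserving_G, bijective_G,
    measurePreserving_G.comp measurePreserving_F, hH, ?_⟩
  conv_lhs => rw [← H_preimage_R]
  exact Set.image_preimage_eq R hH.surjective
end
end

section
/- Almost every point of R returns to S: the set {z ∈ R | for every n ≥ 1, H^[n] z ∉ S} has μ-measure zero. In particular the first-return map H_S is μ-a.e. well defined on R. -/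
open MeasureTheory
open scoped NNReal ENNReal

noncomputable section

lemma coe_θ (x : AddCircle (2:ℝ)) : ((θ x : ℝ) : AddCircle (2:ℝ)) = x :=
  AddCircle.coe_equivIco

lemma coe_two_mul_θ (x : AddCircle (2:ℝ)) :
    ((2 * θ x : ℝ) : AddCircle (2:ℝ)) = 2 • x := by
  rw [two_mul, AddCircle.coe_add, coe_θ, two_nsmul]

/-- The forward orbit of an infinite-order rotation meets the half circle `θ ≤ 1`. -/
lemma exists_θ_add_nsmul_le_one {a : AddCircle (2:ℝ)} (ha : ¬ IsOfFinAddOrder a)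
    (b : AddCircle (2:ℝ)) : ∃ n : ℕ, θ (b + n • a) ≤ 1 := by
  have hd : DenseRange (· • a : ℕ → AddCircle (2:ℝ)) := by
    rw [← denseRange_zsmul_iff_nsmul, AddCircle.denseRange_zsmul_iff]
    exact addOrderOf_eq_zero_iff.2 ha
  have hU : IsOpen ((fun x : ℝ ↦ (x : AddCircle (2:ℝ))) '' Set.Ioo 0 1) :=
    QuotientAddGroup.isOpenMap_coe _ isOpen_Ioo
  obtain ⟨n, x, hx, hn⟩ := hd.exists_mem_open (hU.preimage (continuous_const_add b))
    ⟨((1 / 2 : ℝ) : AddCircle (2:ℝ)) - b, 1 / 2, by norm_num, by simp⟩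
  refine ⟨n, ?_⟩
  change (x : AddCircle (2:ℝ)) = b + n • a at hn
  rw [← hn, θ, AddCircle.equivIco_coe_of_mem ⟨hx.1.le, by linarith [hx.2]⟩]
  exact hx.2.le

lemma not_isOfFinAddOrder_two_nsmul {x : AddCircle (2:ℝ)} (hx : ¬ IsOfFinAddOrder x) :
    ¬ IsOfFinAddOrder (2 • x) := by
  rwa [isOfFinAddOrder_nsmul, or_iff_left two_ne_zero]

lemma H_of_fst {x y : AddCircle (2:ℝ)} (hx : θ x ≤ 1) (hy : ¬ θ y ≤ 1) :
    H (x, y) = (x, y + 2 • x) := by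
  simp [H, F, G, hx, hy, coe_two_mul_θ]

lemma H_of_snd {x y : AddCircle (2:ℝ)} (hy : θ y ≤ 1) (hx : ¬ θ (x + 2 • y) ≤ 1) :
    H (x, y) = (x + 2 • y, y) := by
  simp [H, F, G, hx, hy, coe_two_mul_θ]

lemma H_of_snd_of_add {x y : AddCircle (2:ℝ)} (hy : θ y ≤ 1) (hx : θ (x + 2 • y) ≤ 1) :
    H (x, y) = (x + 2 • y, y + 2 • (x + 2 • y)) := by
  simp [H, F, G, hx, hy, coe_two_mul_θ]

lemma returns_of_H {z : 𝕋} (h : ∃ n, H^[n] (H z) ∈ S) : ∃ n, 1 ≤ n ∧ H^[n] z ∈ S :=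
  let ⟨n, hn⟩ := h
  ⟨n + 1, by omega, hn⟩

lemma exists_iterate_mem_S_of_fst {x y : AddCircle (2:ℝ)} (hx : ¬ IsOfFinAddOrder x)
    (hxQ : θ x ≤ 1) : ∃ n, H^[n] (x, y) ∈ S := by
  obtain ⟨n, hn⟩ := exists_θ_add_nsmul_le_one (not_isOfFinAddOrder_two_nsmul hx) y
  induction n generalizing y with
  | zero => exact ⟨0, show θ y ≤ 1 by simpa using hn, hxQ⟩
  | succ n ih =>
    by_cases hy : θ y ≤ 1
    · exact ⟨0, hy, hxQ⟩
    obtain ⟨m, hm⟩ := ih (y := y + 2 • x) (by rwa [add_assoc, ← succ_nsmul'])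
    exact ⟨m + 1, by rwa [Function.iterate_succ_apply, H_of_fst hxQ hy]⟩

lemma returns_of_snd {x y : AddCircle (2:ℝ)} (hy : ¬ IsOfFinAddOrder y)
    (hx : ∀ k : ℕ, ¬ IsOfFinAddOrder (x + k • 2 • y)) (hyP : θ y ≤ 1) :
    ∃ n, 1 ≤ n ∧ H^[n] (x, y) ∈ S := by
  obtain ⟨n, hn⟩ :=
    exists_θ_add_nsmul_le_one (not_isOfFinAddOrder_two_nsmul hy) (x + 2 • y)
  induction n generalizing x with
  | zero =>
    rw [zero_nsmul, add_zero] at hn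
    apply returns_of_H
    rw [H_of_snd_of_add hyP hn]
    exact exists_iterate_mem_S_of_fst (by simpa using hx 1) hn
  | succ n ih =>
    apply returns_of_H
    by_cases hQ : θ (x + 2 • y) ≤ 1
    · rw [H_of_snd_of_add hyP hQ]
      exact exists_iterate_mem_S_of_fst (by simpa using hx 1) hQ
    · rw [H_of_snd hyP hQ]
      obtain ⟨m, -, hm⟩ := ih (x := x + 2 • y)
        (fun k ↦ by simpa only [add_assoc, ← succ_nsmul'] using hx (k + 1))
        (by rwa [add_assoc, ← succ_nsmul'])
      exact ⟨m, hm⟩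

lemma returns_of_mem_R {z : 𝕋} (h₂ : ¬ IsOfFinAddOrder z.2)
    (h₁ : ∀ k : ℕ, ¬ IsOfFinAddOrder (z.1 + k • 2 • z.2)) (hz : z ∈ R) :
    ∃ n, 1 ≤ n ∧ H^[n] z ∈ S := by
  obtain ⟨x, y⟩ := z
  by_cases hP : θ y ≤ 1
  · exact returns_of_snd h₂ h₁ hP
  · have hQ : θ x ≤ 1 := hz.resolve_left hP
    apply returns_of_H
    rw [H_of_fst hQ hP]
    exact exists_iterate_mem_S_of_fst (by simpa using h₁ 0) hQ

lemma countable_isOfFinAddOrder : {x : AddCircle (2:ℝ) | IsOfFinAddOrder x}.Countable := by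
  refine (Set.countable_iUnion fun n : ℕ ↦
    (AddCircle.finite_torsion (2:ℝ) n.succ_pos).countable).mono fun x hx ↦ ?_
  obtain ⟨n, hn, h⟩ := isOfFinAddOrder_iff_nsmul_eq_zero.1 hx
  exact Set.mem_iUnion.2 ⟨n - 1, by simpa [Nat.sub_add_cancel hn] using h⟩

instance : NullSingletonClass (volume : Measure (AddCircle (2:ℝ))) where
  measure_singleton x := by
    simpa using AddCircle.volume_closedBall (2:ℝ) (x := x) 0

lemma ae_not_isOfFinAddOrder_add {f : AddCircle (2:ℝ) → AddCircle (2:ℝ)}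
    (hf : Measurable f) :
    ∀ᵐ z : 𝕋, ¬ IsOfFinAddOrder (z.1 + f z.2) := by
  have hc := countable_isOfFinAddOrder
  have hm : MeasurableSet {z : 𝕋 | IsOfFinAddOrder (z.1 + f z.2)} :=
    (measurable_fst.add (hf.comp measurable_snd)) hc.measurableSet
  simp only [ae_iff, not_not]
  rw [Measure.volume_eq_prod, Measure.prod_apply_symm hm]
  exact (lintegral_congr fun y ↦
    (hc.preimage (add_left_injective (f y))).measure_zero volume).trans lintegral_zero

lemma ae_not_isOfFinAddOrder_snd : ∀ᵐ z : 𝕋, ¬ IsOfFinAddOrder z.2 :=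
  Measure.quasiMeasurePreserving_snd.ae
    (p := fun y ↦ ¬ IsOfFinAddOrder y)
    (by simpa [ae_iff] using countable_isOfFinAddOrder.measure_zero volume)

/-- Almost every point of `R` returns to `S` under iteration of `H`. -/
theorem ae_return_to_S :
    (volume : Measure 𝕋) {z | z ∈ R ∧ ∀ n : ℕ, 1 ≤ n → H^[n] z ∉ S} = 0 := by
  have h : ∀ᵐ z : 𝕋, ¬ (z ∈ R ∧ ∀ n : ℕ, 1 ≤ n → H^[n] z ∉ S) := by
    filter_upwards [ae_not_isOfFinAddOrder_snd, ae_all_iff.2 fun k : ℕ ↦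
      ae_not_isOfFinAddOrder_add (f := fun y ↦ k • 2 • y) (by fun_prop)]
      with z h₂ h₁ ⟨hz, hS⟩
    obtain ⟨n, hn, hnS⟩ := returns_of_mem_R h₂ h₁ hz
    exact hS n hn hnS
  simpa only [ae_iff, not_not] using h
end
end

section
/- Isolation of large return times: there exist constants K > 0 and k > 0 such that for all natural numbers N ≥ 1 and n, and every z ∈ S_n, if (n : ℝ) > K * Real.exp (k * N) then for every i with 1 ≤ i ≤ N both H_S^[i] z ∈ S_1 and H'_S^[i] z ∈ S_1, where H'_S denotes the return map of the inverse H' of H to S. -/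
open MeasureTheory
open scoped NNReal ENNReal

noncomputable section

/-- The inverse horizontal twist. -/
def F' (z : 𝕋) : 𝕋 :=
  if θ z.2 ≤ 1 then (z.1 - (((2 * θ z.2 : ℝ) : AddCircle (2:ℝ))), z.2) else z

/-- The inverse vertical twist. -/
def G' (z : 𝕋) : 𝕋 :=
  if θ z.1 ≤ 1 then (z.1, z.2 - (((2 * θ z.1 : ℝ) : AddCircle (2:ℝ)))) else z

/-- The inverse of the linked-twist map. -/
def H' : 𝕋 → 𝕋 := F' ∘ G'

/-- The point of the torus with the given real coordinates. -/
def pt (x y : ℝ) : 𝕋 := ((x : AddCircle (2:ℝ)), (y : AddCircle (2:ℝ)))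

/-- The point reflection of the torus about `(1/2, 1/2)`. -/
def reflect (z : 𝕋) : 𝕋 :=
  (((1:ℝ) : AddCircle (2:ℝ)) - z.1, ((1:ℝ) : AddCircle (2:ℝ)) - z.2)

theorem θ_coe {x : ℝ} (h0 : 0 ≤ x) (h2 : x < 2) : θ (x : AddCircle (2:ℝ)) = x := by
  have hx : x ∈ Set.Ico (0:ℝ) (0 + 2) := ⟨h0, by linarith⟩
  unfold θ
  rw [AddCircle.equivIco_coe_eq hx]

theorem coe_add_two (x : ℝ) : ((x + 2 : ℝ) : AddCircle (2:ℝ)) = x :=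
  AddCircle.coe_add_period 2 x

theorem exists_coe (a : AddCircle (2:ℝ)) :
    ∃ x : ℝ, 0 ≤ x ∧ x < 2 ∧ (x : AddCircle (2:ℝ)) = a := by
  have h := ((AddCircle.equivIco (2:ℝ) 0) a).2
  refine ⟨(AddCircle.equivIco (2:ℝ) 0) a, h.1, by linarith [h.2], ?_⟩
  exact (AddCircle.equivIco (2:ℝ) 0).symm_apply_apply a

theorem exists_pt (z : 𝕋) :
    ∃ x y : ℝ, 0 ≤ x ∧ x < 2 ∧ 0 ≤ y ∧ y < 2 ∧ z = pt x y := by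
  obtain ⟨x, hx0, hx2, hx⟩ := exists_coe z.1
  obtain ⟨y, hy0, hy2, hy⟩ := exists_coe z.2
  exact ⟨x, y, hx0, hx2, hy0, hy2, Prod.ext hx.symm hy.symm⟩

theorem pt_add_two_left (x y : ℝ) : pt (x + 2) y = pt x y := by
  simp only [pt, coe_add_two]

theorem pt_add_two_right (x y : ℝ) : pt x (y + 2) = pt x y := by
  simp only [pt, coe_add_two]

theorem reflect_pt (x y : ℝ) : reflect (pt x y) = pt (1 - x) (1 - y) := by
  simp only [reflect, pt, AddCircle.coe_sub]

theorem pt_mem_S_iff {x y : ℝ} (hx0 : 0 ≤ x) (hx2 : x < 2) (hy0 : 0 ≤ y) (hy2 : y < 2) :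
    pt x y ∈ S ↔ x ≤ 1 ∧ y ≤ 1 := by
  simp only [S, P, Q, pt, Set.mem_inter_iff, Set.mem_ofPred_eq, θ_coe hx0 hx2, θ_coe hy0 hy2]
  exact and_comm

theorem pt_mem_S {x y : ℝ} (hx0 : 0 ≤ x) (hx1 : x ≤ 1) (hy0 : 0 ≤ y) (hy1 : y ≤ 1) :
    pt x y ∈ S :=
  (pt_mem_S_iff hx0 (by linarith) hy0 (by linarith)).2 ⟨hx1, hy1⟩

theorem F_pt {x y : ℝ} (h0 : 0 ≤ y) (h1 : y ≤ 1) : F (pt x y) = pt (x + 2 * y) y := by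
  simp [F, pt, θ_coe h0 (by linarith), h1]

theorem F_pt_of_one_lt {x y : ℝ} (h1 : 1 < y) (h2 : y < 2) : F (pt x y) = pt x y := by
  simp [F, pt, θ_coe (by linarith) h2, h1.not_ge]

theorem G_pt {x y : ℝ} (h0 : 0 ≤ x) (h1 : x ≤ 1) : G (pt x y) = pt x (y + 2 * x) := by
  simp [G, pt, θ_coe h0 (by linarith), h1]

theorem G_pt_of_one_lt {x y : ℝ} (h1 : 1 < x) (h2 : x < 2) : G (pt x y) = pt x y := by
  simp [G, pt, θ_coe (by linarith) h2, h1.not_ge]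

theorem F'_pt {x y : ℝ} (h0 : 0 ≤ y) (h1 : y ≤ 1) : F' (pt x y) = pt (x - 2 * y) y := by
  simp [F', pt, θ_coe h0 (by linarith), h1]

theorem G'_pt {x y : ℝ} (h0 : 0 ≤ x) (h1 : x ≤ 1) : G' (pt x y) = pt x (y - 2 * x) := by
  simp [G', pt, θ_coe h0 (by linarith), h1]

theorem H_H' (z : 𝕋) : H (H' z) = z := by
  have hF (w : 𝕋) : F (F' w) = w := by
    by_cases h : θ w.2 ≤ 1 <;> simp [F, F', h]
  have hG (w : 𝕋) : G (G' w) = w := by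
    by_cases h : θ w.1 ≤ 1 <;> simp [G, G', h]
  simp only [H, H', Function.comp_apply, hF, hG]

theorem θ_one_sub_le_one_iff (a : AddCircle (2:ℝ)) :
    θ (((1:ℝ) : AddCircle (2:ℝ)) - a) ≤ 1 ↔ θ a ≤ 1 := by
  obtain ⟨x, h0, h2, rfl⟩ := exists_coe a
  rw [← AddCircle.coe_sub, θ_coe h0 h2]
  rcases le_or_gt x 1 with h | h
  · rw [θ_coe (by linarith) (by linarith)]
    constructor <;> intro <;> linarith
  · rw [← coe_add_two, θ_coe (by linarith) (by linarith)]
    constructor <;> intro <;> linarith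

theorem coe_two_mul_θ_one_sub {a : AddCircle (2:ℝ)} (h : θ a ≤ 1) :
    ((2 * θ (((1:ℝ) : AddCircle (2:ℝ)) - a) : ℝ) : AddCircle (2:ℝ)) =
      -((2 * θ a : ℝ) : AddCircle (2:ℝ)) := by
  obtain ⟨x, h0, h2, rfl⟩ := exists_coe a
  rw [θ_coe h0 h2] at h
  rw [← AddCircle.coe_sub, θ_coe h0 h2, θ_coe (by linarith) (by linarith), ← AddCircle.coe_neg,
    ← coe_add_two (-(2 * x))]
  congr 1
  ring

theorem F_reflect (z : 𝕋) : F (reflect z) = reflect (F z) := by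
  by_cases h : θ z.2 ≤ 1
  · simp only [F, reflect, θ_one_sub_le_one_iff, h, if_true, coe_two_mul_θ_one_sub h]
    exact Prod.ext (by dsimp only; abel) rfl
  · simp only [F, reflect, θ_one_sub_le_one_iff, h, if_false]

theorem G_reflect (z : 𝕋) : G (reflect z) = reflect (G z) := by
  by_cases h : θ z.1 ≤ 1
  · simp only [G, reflect, θ_one_sub_le_one_iff, h, if_true, coe_two_mul_θ_one_sub h]
    exact Prod.ext rfl (by dsimp only; abel)
  · simp only [G, reflect, θ_one_sub_le_one_iff, h, if_false]

theorem F'_reflect (z : 𝕋) : F' (reflect z) = reflect (F' z) := by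
  by_cases h : θ z.2 ≤ 1
  · simp only [F', reflect, θ_one_sub_le_one_iff, h, if_true, coe_two_mul_θ_one_sub h]
    exact Prod.ext (by dsimp only; abel) rfl
  · simp only [F', reflect, θ_one_sub_le_one_iff, h, if_false]

theorem G'_reflect (z : 𝕋) : G' (reflect z) = reflect (G' z) := by
  by_cases h : θ z.1 ≤ 1
  · simp only [G', reflect, θ_one_sub_le_one_iff, h, if_true, coe_two_mul_θ_one_sub h]
    exact Prod.ext rfl (by dsimp only; abel)
  · simp only [G', reflect, θ_one_sub_le_one_iff, h, if_false]

theorem H_reflect : Function.Semiconj reflect H H := fun z => by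
  simp only [H, Function.comp_apply, F_reflect, G_reflect]

theorem H'_reflect : Function.Semiconj reflect H' H' := fun z => by
  simp only [H', Function.comp_apply, F'_reflect, G'_reflect]

theorem reflect_mem_S_iff (z : 𝕋) : reflect z ∈ S ↔ z ∈ S := by
  simp only [S, P, Q, reflect, Set.mem_inter_iff, Set.mem_ofPred_eq, θ_one_sub_le_one_iff]

theorem rtn_reflect {T : 𝕋 → 𝕋} (hT : Function.Semiconj reflect T T) (z : 𝕋) :
    rtn T (reflect z) = rtn T z := by
  unfold rtn
  simp only [← (hT.iterate_right _).eq, reflect_mem_S_iff]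

theorem retMap_reflect {T : 𝕋 → 𝕋} (hT : Function.Semiconj reflect T T) :
    Function.Semiconj reflect (retMap T) (retMap T) := fun z => by
  simp only [retMap, rtn_reflect hT, (hT.iterate_right _).eq]

theorem reflect_mem_Sn_iff (n : ℕ) (z : 𝕋) : reflect z ∈ Sn n ↔ z ∈ Sn n := by
  simp only [Sn, Set.mem_ofPred_eq, reflect_mem_S_iff, rtn_reflect H_reflect]

theorem rtn_le {T : 𝕋 → 𝕋} {z : 𝕋} {m : ℕ} (hm : 1 ≤ m) (h : T^[m] z ∈ S) : rtn T z ≤ m :=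
  Nat.sInf_le ⟨hm, h⟩

theorem rtn_eq {T : 𝕋 → 𝕋} {z : 𝕋} {m : ℕ} (hm : 1 ≤ m) (h : T^[m] z ∈ S)
    (hlt : ∀ j, 1 ≤ j → j < m → T^[j] z ∉ S) : rtn T z = m := by
  refine le_antisymm (rtn_le hm h) (le_csInf ⟨m, hm, h⟩ ?_)
  rintro j ⟨hj, hjS⟩
  by_contra! hjm
  exact hlt j hj hjm hjS

theorem rtn_eq_one {T : 𝕋 → 𝕋} {z : 𝕋} (h : T z ∈ S) : rtn T z = 1 :=
  rtn_eq le_rfl h (by omega)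

theorem retMap_eq {T : 𝕋 → 𝕋} {z : 𝕋} (h : T z ∈ S) : retMap T z = T z := by
  rw [retMap, rtn_eq_one h, Function.iterate_one]

/-- Translating by `s > 0` leaves `(1, 2)` after at most `1 + 1/s` steps. -/
theorem exists_escape_time {x s : ℝ} (hx1 : 1 < x) (hx2 : x < 2) (hs : 0 < s) :
    ∃ m : ℕ, 1 ≤ m ∧ s * (m - 1) ≤ 1 ∧ (∀ j : ℕ, j < m → x + s * j < 2) ∧
      2 ≤ x + s * m ∧ x + s * m < 2 + s := by
  have hpos : 0 < (2 - x) / s := div_pos (by linarith) hs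
  have hlt : (⌈(2 - x) / s⌉₊ : ℝ) < (2 - x) / s + 1 := Nat.ceil_lt_add_one hpos.le
  have hle := Nat.le_ceil ((2 - x) / s)
  have hcancel : s * ((2 - x) / s) = 2 - x := mul_div_cancel₀ _ hs.ne'
  refine ⟨⌈(2 - x) / s⌉₊, Nat.ceil_pos.2 hpos, by nlinarith, fun j hj => ?_, by nlinarith,
    by nlinarith⟩
  have := Nat.lt_ceil.1 hj
  nlinarith

theorem exists_exit_horizontal {x y : ℝ} (hx1 : 1 < x) (hx2 : x < 2) (hy0 : 0 < y)
    (hy : y ≤ 1 / 2) :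
    ∃ m : ℕ, 1 ≤ m ∧ 2 * y * (m - 1) ≤ 1 ∧ (∀ j : ℕ, j < m → H^[j] (pt x y) ∉ S) ∧
      ∃ u, 0 ≤ u ∧ u < 2 * y ∧ H^[m] (pt x y) = pt u (y + 2 * u) := by
  obtain ⟨m, hm, hms, hlt, hge, hlt'⟩ := exists_escape_time hx1 hx2 (s := 2 * y) (by linarith)
  have key (j : ℕ) (hj : j < m) : H^[j] (pt x y) = pt (x + 2 * y * j) y := by
    induction j with
    | zero => simp
    | succ j ih =>
      have h := hlt (j + 1) hj
      push_cast at h ⊢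
      have : 0 ≤ 2 * y * j := by positivity
      rw [Function.iterate_succ_apply', ih (by omega), H, Function.comp_apply,
        F_pt hy0.le (by linarith), G_pt_of_one_lt (by linarith) (by linarith)]
      congr 1
      ring
  refine ⟨m, hm, hms, fun j hj => ?_, x + 2 * y * m - 2, by linarith, by linarith, ?_⟩
  · have h := hlt j hj
    have : 0 ≤ 2 * y * j := by positivity
    rw [key j hj, pt_mem_S_iff (by linarith) h hy0.le (by linarith)]
    exact fun h => by linarith [h.1]
  · obtain ⟨k, rfl⟩ : ∃ k, m = k + 1 := ⟨m - 1, by omega⟩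
    rw [Function.iterate_succ_apply', key k (by omega), H, Function.comp_apply,
      F_pt hy0.le (by linarith), ← G_pt (by linarith) (by linarith),
      ← pt_add_two_left (x + _ * _ - 2)]
    congr 2
    push_cast
    ring

theorem exists_exit_vertical {x y : ℝ} (hy1 : 1 < y) (hy2 : y < 2) (hx0 : 0 < x)
    (hx : x ≤ 1 / 2) :
    ∃ m : ℕ, 1 ≤ m ∧ 2 * x * (m - 1) ≤ 1 ∧ (∀ j : ℕ, j < m → H^[j] (pt x y) ∉ S) ∧
      ∃ v, 0 ≤ v ∧ v < 2 * x ∧ H^[m] (pt x y) = pt x v := by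
  obtain ⟨m, hm, hms, hlt, hge, hlt'⟩ := exists_escape_time hy1 hy2 (s := 2 * x) (by linarith)
  have step (j : ℕ) (hj : j < m) :
      H (pt x (y + 2 * x * j)) = pt x (y + 2 * x * (j + 1)) := by
    have : 0 ≤ 2 * x * j := by positivity
    rw [H, Function.comp_apply, F_pt_of_one_lt (by linarith) (hlt j hj),
      G_pt hx0.le (by linarith)]
    congr 1
    ring
  have key (j : ℕ) (hj : j ≤ m) : H^[j] (pt x y) = pt x (y + 2 * x * j) := by
    induction j with
    | zero => simp
    | succ j ih =>
      rw [Function.iterate_succ_apply', ih (by omega), step j (by omega)]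
      push_cast
      rfl
  refine ⟨m, hm, hms, fun j hj => ?_, y + 2 * x * m - 2, by linarith, by linarith, ?_⟩
  · have h := hlt j hj
    have : 0 ≤ 2 * x * j := by positivity
    rw [key j hj.le, pt_mem_S_iff hx0.le (by linarith) (by linarith) h]
    exact fun h => by linarith [h.2]
  · rw [key m le_rfl, ← pt_add_two_right _ (y + _ - 2)]
    congr 1
    ring

theorem exists_exit_vertical_reflect {d y : ℝ} (hy1 : 1 < y) (hy2 : y < 2) (hd0 : 0 < d)
    (hd : d ≤ 1 / 2) :
    ∃ m : ℕ, 1 ≤ m ∧ 2 * d * (m - 1) ≤ 1 ∧ (∀ j : ℕ, j < m → H^[j] (pt (1 - d) y) ∉ S) ∧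
      ∃ v, 0 ≤ v ∧ v < 2 * d ∧ H^[m] (pt (1 - d) y) = reflect (pt d v) := by
  obtain ⟨m, hm, hms, hlt, v, hv0, hv, h⟩ :=
    exists_exit_vertical (x := d) (y := 3 - y) (by linarith) (by linarith) hd0 hd
  have hpt : pt (1 - d) y = reflect (pt d (3 - y)) := by
    rw [reflect_pt, ← pt_add_two_right _ (1 - (3 - y))]
    congr 1
    ring
  refine ⟨m, hm, hms, fun j hj => ?_, v, hv0, hv, ?_⟩
  · rw [hpt, ← (H_reflect.iterate_right j).eq, reflect_mem_S_iff]
    exact hlt j hj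
  · rw [hpt, ← (H_reflect.iterate_right m).eq, h]

/-- Orbits with a large return time start close to the corner `(1, 0)` of `S`, and return close
to one of the corners `(0, 0)` and `(1, 1)`. -/
theorem near_corner_of_large_rtn {x y : ℝ} (hx0 : 0 ≤ x) (hx1 : x ≤ 1) (hy0 : 0 ≤ y)
    (hy : y ≤ 1 / 2) (hn : 10 < rtn H (pt x y)) :
    ∃ d : ℝ, 0 < d ∧ 2 * d * ((rtn H (pt x y) : ℝ) - 2) ≤ 1 ∧
      1 - x ≤ 5 * d ∧ y ≤ 5 * d ∧
      ∃ u v : ℝ, 0 ≤ u ∧ u ≤ 5 * d ∧ 0 ≤ v ∧ v ≤ 5 * d ∧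
        (retMap H (pt x y) = pt u v ∨ retMap H (pt x y) = reflect (pt u v)) := by
  have not_S (m : ℕ) (hm : 1 ≤ m) (hm' : m ≤ 10) : H^[m] (pt x y) ∉ S := fun h => by
    have := rtn_le hm h
    omega
  have hF : F (pt x y) = pt (x + 2 * y) y := F_pt hy0 (by linarith)
  have hG : H (pt x y) = G (pt (x + 2 * y) y) := by rw [H, Function.comp_apply, hF]
  have hH (j : ℕ) : H^[j + 1] (pt x y) = H^[j] (G (pt (x + 2 * y) y)) := by
    rw [Function.iterate_succ_apply, hG]
  have bound {c : ℝ} {m k : ℕ} (hc : 0 < c) (h : 2 * c * ((m : ℝ) - 1) ≤ 1)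
      (hk : 1 ≤ 2 * c * k) : m ≤ k + 1 := by
    have : (m : ℝ) ≤ k + 1 := by nlinarith
    exact_mod_cast this
  rcases le_or_gt (x + 2 * y) 1 with h1 | h1
  · rw [G_pt (by linarith) h1] at hG hH
    generalize hx' : x + 2 * y = x' at *
    have hn1 := not_S 1 le_rfl (by norm_num)
    rw [Function.iterate_one, hG] at hn1
    have hgt : 1 < y + 2 * x' := by
      by_contra! h
      exact hn1 (pt_mem_S (by linarith) h1 (by linarith) h)
    have hlt : y + 2 * x' < 2 := by
      by_contra! h
      refine hn1 ?_
      rw [← sub_add_cancel (y + 2 * x') 2, pt_add_two_right]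
      exact pt_mem_S (by linarith) h1 (by linarith) (by linarith)
    rcases le_or_gt x' (1 / 2) with h2 | h2
    · obtain ⟨m, hm, hms, -, v, hv0, hv, h⟩ :=
        exists_exit_vertical hgt hlt (by linarith : 0 < x') h2
      have := bound (k := 2) (by linarith) hms (by push_cast; linarith)
      refine absurd ?_ (not_S (m + 1) (by omega) (by omega))
      rw [hH, h]
      exact pt_mem_S (by linarith) h1 hv0 (by linarith)
    · obtain ⟨d, rfl⟩ : ∃ d, x' = 1 - d := ⟨1 - x', by ring⟩
      obtain ⟨m, hm, hms, hnot, v, hv0, hv, h⟩ :=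
        exists_exit_vertical_reflect hgt hlt (by linarith : 0 < d) (by linarith)
      have hr : rtn H (pt x y) = m + 1 := by
        refine rtn_eq (by omega) ?_ fun j hj hjm => ?_
        · rw [hH, h, reflect_mem_S_iff]
          exact pt_mem_S (by linarith) (by linarith) hv0 (by linarith)
        · obtain ⟨j, rfl⟩ : ∃ k, j = k + 1 := ⟨j - 1, by omega⟩
          rw [hH]
          exact hnot j (by omega)
      refine ⟨d, by linarith, ?_, by linarith, by linarith, d, v, by linarith, by linarith, hv0,
        by linarith, Or.inr ?_⟩
      · rw [hr]
        push_cast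
        linarith
      · rw [retMap, hr, hH, h]
  · have hlt : x + 2 * y < 2 := by
      by_contra! h
      refine not_S 1 le_rfl (by norm_num) ?_
      have : x = 1 := by linarith
      have : y = 1 / 2 := by linarith
      subst x y
      rw [Function.iterate_one, hG, show (1:ℝ) + 2 * (1 / 2) = 0 + 2 by norm_num,
        pt_add_two_left, G_pt le_rfl zero_le_one]
      exact pt_mem_S le_rfl zero_le_one (by norm_num) (by norm_num)
    have hy0' : 0 < y := by linarith
    rw [G_pt_of_one_lt h1 hlt] at hG hH
    obtain ⟨m, hm, hms, hnot, u, hu0, hu, h⟩ := exists_exit_horizontal h1 hlt hy0' hy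
    rcases le_or_gt (y + 2 * u) 1 with h2 | h2
    · have hr : rtn H (pt x y) = m + 1 := by
        refine rtn_eq (by omega) ?_ fun j hj hjm => ?_
        · rw [hH, h]
          exact pt_mem_S hu0 (by linarith) (by linarith) h2
        · obtain ⟨j, rfl⟩ : ∃ k, j = k + 1 := ⟨j - 1, by omega⟩
          rw [hH]
          exact hnot j (by omega)
      refine ⟨y, hy0', ?_, by linarith, by linarith, u, y + 2 * u, hu0, by linarith,
        by linarith, by linarith, Or.inl ?_⟩
      · rw [hr]
        push_cast
        linarith
      · rw [retMap, hr, hH, h]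
    · exfalso
      have hm3 := bound (k := 3) hy0' hms (by push_cast; linarith)
      have hlt2 : y + 2 * u < 2 := by
        by_contra! h3
        refine not_S (m + 1) (by omega) (by omega) ?_
        rw [hH, h, ← sub_add_cancel (y + 2 * u) 2, pt_add_two_right]
        exact pt_mem_S hu0 (by linarith) (by linarith) (by linarith)
      have hH2 (j : ℕ) : H^[j + (m + 1)] (pt x y) = H^[j] (pt u (y + 2 * u)) := by
        rw [Function.iterate_add_apply, hH, h]
      rcases le_or_gt u (1 / 2) with h3 | h3
      · obtain ⟨l, hl, hls, -, v, hv0, hv, h'⟩ :=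
          exists_exit_vertical h2 hlt2 (by linarith : 0 < u) h3
        have := bound (k := 2) (by linarith) hls (by push_cast; linarith)
        refine not_S (l + (m + 1)) (by omega) (by omega) ?_
        rw [hH2, h']
        exact pt_mem_S hu0 (by linarith) hv0 (by linarith)
      · obtain ⟨d, rfl⟩ : ∃ d, u = 1 - d := ⟨1 - u, by ring⟩
        obtain ⟨l, hl, hls, -, v, hv0, hv, h'⟩ :=
          exists_exit_vertical_reflect h2 hlt2 (by linarith : 0 < d) (by linarith)
        have := bound (k := 4) (by linarith) hls (by push_cast; linarith)
        refine not_S (l + (m + 1)) (by omega) (by omega) ?_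
        rw [hH2, h', reflect_mem_S_iff]
        exact pt_mem_S (by linarith) (by linarith) hv0 (by linarith)

theorem seven_mul_le_one {t : ℝ} (i : ℕ) (ht0 : 0 ≤ t) (ht : 7 ^ (i + 1) * t ≤ 1) :
    7 * t ≤ 1 :=
  le_trans (mul_le_mul_of_nonneg_right (le_self_pow₀ (by norm_num) (by omega)) ht0) ht

theorem forward_isolated {t a b : ℝ} {i : ℕ} (ht : 7 ^ (i + 1) * t ≤ 1) (ha0 : 0 ≤ a)
    (ha : a ≤ t) (hb0 : 0 ≤ b) (hb : b ≤ t) : (retMap H)^[i] (pt a b) ∈ Sn 1 := by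
  induction i generalizing t a b with
  | zero =>
    have ht7 := seven_mul_le_one 0 (ha0.trans ha) ht
    rw [Function.iterate_zero_apply]
    refine ⟨pt_mem_S ha0 (by linarith) hb0 (by linarith), rtn_eq_one ?_⟩
    rw [H, Function.comp_apply, F_pt hb0 (by linarith), G_pt (by linarith) (by linarith)]
    exact pt_mem_S (by linarith) (by linarith) (by linarith) (by linarith)
  | succ i ih =>
    have ht7 := seven_mul_le_one (i + 1) (ha0.trans ha) ht
    have hH : H (pt a b) = pt (a + 2 * b) (b + 2 * (a + 2 * b)) := by
      rw [H, Function.comp_apply, F_pt hb0 (by linarith), G_pt (by linarith) (by linarith)]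
    rw [Function.iterate_succ_apply, retMap_eq, hH]
    · exact ih (t := 7 * t) (by rwa [← mul_assoc, ← pow_succ]) (by linarith) (by linarith)
        (by linarith) (by linarith)
    · rw [hH]
      exact pt_mem_S (by linarith) (by linarith) (by linarith) (by linarith)

theorem H'_near_corner {t a b : ℝ} (ht : 7 * t ≤ 1) (ha0 : 0 ≤ a) (ha : a ≤ t) (hb0 : 0 ≤ b)
    (hb : b ≤ t) :
    H' (pt (1 - a) b) = pt (1 - (a + 2 * (b + 2 * a))) (b + 2 * a) ∧ H' (pt (1 - a) b) ∈ S := by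
  have hH : H' (pt (1 - a) b) = pt (1 - (a + 2 * (b + 2 * a))) (b + 2 * a) := by
    rw [H', Function.comp_apply, G'_pt (by linarith) (by linarith), ← pt_add_two_right,
      show b - 2 * (1 - a) + 2 = b + 2 * a by ring, F'_pt (by linarith) (by linarith)]
    congr 1
    ring
  refine ⟨hH, ?_⟩
  rw [hH]
  exact pt_mem_S (by linarith) (by linarith) (by linarith) (by linarith)

theorem backward_isolated {t a b : ℝ} {i : ℕ} (ht : 7 ^ (i + 1) * t ≤ 1) (ha0 : 0 ≤ a)
    (ha : a ≤ t) (hb0 : 0 ≤ b) (hb : b ≤ t) :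
    (retMap H')^[i + 1] (pt (1 - a) b) ∈ Sn 1 := by
  have ht7 := seven_mul_le_one i (ha0.trans ha) ht
  obtain ⟨hH, hS⟩ := H'_near_corner ht7 ha0 ha hb0 hb
  rw [Function.iterate_succ_apply, retMap_eq hS]
  induction i generalizing t a b with
  | zero =>
    rw [Function.iterate_zero_apply]
    refine ⟨hS, rtn_eq_one ?_⟩
    rw [H_H']
    exact pt_mem_S (by linarith) (by linarith) hb0 (by linarith)
  | succ i ih =>
    have ht' : 7 ^ (i + 1) * (7 * t) ≤ 1 := by rwa [← mul_assoc, ← pow_succ]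
    have ht7' := seven_mul_le_one i (by linarith) ht'
    obtain ⟨hH', hS'⟩ := H'_near_corner (a := a + 2 * (b + 2 * a)) (b := b + 2 * a) ht7'
      (by linarith) (by linarith) (by linarith) (by linarith)
    rw [hH, Function.iterate_succ_apply, retMap_eq hS']
    exact ih ht' (by linarith) (by linarith) (by linarith) (by linarith) ht7' hH' hS'

theorem isolated_of_le_half {N n : ℕ} {x y : ℝ} (hx0 : 0 ≤ x) (hx1 : x ≤ 1) (hy0 : 0 ≤ y)
    (hy : y ≤ 1 / 2) (hz : rtn H (pt x y) = n) (hn : (20 : ℝ) * Real.exp (6 * N) < n)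
    {i : ℕ} (hi : 1 ≤ i) (hiN : i ≤ N) :
    (retMap H)^[i] (pt x y) ∈ Sn 1 ∧ (retMap H')^[i] (pt x y) ∈ Sn 1 := by
  obtain ⟨i, rfl⟩ : ∃ k, i = k + 1 := ⟨i - 1, by omega⟩
  have h7 : (7:ℝ) ^ (i + 1) ≤ Real.exp (6 * N) := by
    rw [mul_comm, Real.exp_nat_mul]
    calc (7:ℝ) ^ (i + 1) ≤ 7 ^ N := pow_le_pow_right₀ (by norm_num) hiN
      _ ≤ Real.exp 6 ^ N := by
        gcongr
        linarith [Real.add_one_le_exp (6:ℝ)]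
  have h1 : (1:ℝ) ≤ 7 ^ (i + 1) := one_le_pow₀ (by norm_num)
  have hn10 : 10 < rtn H (pt x y) := by
    rw [hz]
    have : (10:ℝ) < n := by linarith
    exact_mod_cast this
  obtain ⟨d, hd, hdn, hxd, hyd, u, v, hu0, hu, hv0, hv, huv⟩ :=
    near_corner_of_large_rtn hx0 hx1 hy0 hy hn10
  rw [hz] at hdn
  have ht : (7:ℝ) ^ (i + 1) * (5 * d) ≤ 1 := by nlinarith
  constructor
  · rw [Function.iterate_succ_apply]
    rcases huv with h | h <;> rw [h]
    · exact forward_isolated ht hu0 hu hv0 hv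
    · rw [← ((retMap_reflect H_reflect).iterate_right i).eq, reflect_mem_Sn_iff]
      exact forward_isolated ht hu0 hu hv0 hv
  · have h := backward_isolated ht (by linarith : 0 ≤ 1 - x) hxd hy0 hyd
    rwa [sub_sub_cancel] at h

/-- Isolation of large return times: if `z` has a very large return time then a controlled
number of its forward and backward `H_S`-iterates lie in `S₁`. -/
theorem isolation_of_large_return_times :
    ∃ K : ℝ, 0 < K ∧ ∃ k : ℝ, 0 < k ∧
      ∀ N : ℕ, 1 ≤ N → ∀ n : ℕ, ∀ z ∈ Sn n,
        (n : ℝ) > K * Real.exp (k * N) →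
          ∀ i : ℕ, 1 ≤ i → i ≤ N →
            (retMap H)^[i] z ∈ Sn 1 ∧ (retMap H')^[i] z ∈ Sn 1 := by
  refine ⟨20, by norm_num, 6, by norm_num, ?_⟩
  rintro N - n z ⟨hzS, hz⟩ hn i hi hiN
  obtain ⟨x, y, hx0, hx2, hy0, hy2, rfl⟩ := exists_pt z
  obtain ⟨hx1, hy1⟩ := (pt_mem_S_iff hx0 hx2 hy0 hy2).1 hzS
  rcases le_total y (1 / 2) with hy | hy
  · exact isolated_of_le_half hx0 hx1 hy0 hy hz hn hi hiN
  · rw [← rtn_reflect H_reflect, reflect_pt] at hz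
    have h := isolated_of_le_half (by linarith) (by linarith) (by linarith) (by linarith)
      hz hn hi hiN
    rw [← reflect_pt, ← ((retMap_reflect H_reflect).iterate_right i).eq, reflect_mem_Sn_iff,
      ← ((retMap_reflect H'_reflect).iterate_right i).eq, reflect_mem_Sn_iff] at h
    exact h
end
end
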